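/- arXiv:cs/0301026 — 2 statements merged into one kernel-verified Lean document; each statement's English description precedes it below -/
import Mathlib

section
/- From the Łukasiewicz axioms L1, L2, L3, there exist double-negation-free condensed-detachment proofs of each of the formulas L4 = i(i(x,n(x)),n(x)) and L5 = i(n(x),i(x,y)). -/
/-- Propositional formulas built from countably many variables by implication `i`
and negation `n`. -/
inductive Fm : Type
  | var : ℕ → Fm
  | i : Fm → Fm → Fm
  | n : Fm → Fm
  deriving DecidableEq

namespace Fm

/-- Homomorphic extension of a substitution (of formulas for variables). -/
def subst (σ : ℕ → Fm) : Fm → Fm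
  | var k => σ k
  | i a b => i (subst σ a) (subst σ b)
  | n a => n (subst σ a)

/-- The (finite) set of variables occurring in a formula. -/
def vars : Fm → Finset ℕ
  | var k => {k}
  | i a b => vars a ∪ vars b
  | n a => vars a

/-- `Sub s t` : `s` is a (not necessarily proper) subformula of `t`. -/
inductive Sub : Fm → Fm → Prop
  | refl (t : Fm) : Sub t t
  | il {s a b : Fm} : Sub s a → Sub s (i a b)
  | ir {s a b : Fm} : Sub s b → Sub s (i a b)
  | neg {s a : Fm} : Sub s a → Sub s (n a)

end Fm

/-- The renaming substitution induced by a permutation of the variables. -/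
def renameSubst (p : Equiv.Perm ℕ) : ℕ → Fm := fun k => Fm.var (p k)

/-- `AlphVar A B` : `B` is an alphabetic variant of `A`
(obtained from `A` by an injective renaming of variables). -/
def AlphVar (A B : Fm) : Prop := ∃ p : Equiv.Perm ℕ, B = A.subst (renameSubst p)

/-- `σ` unifies `A` and `C`. -/
def Unifies (σ : ℕ → Fm) (A C : Fm) : Prop := A.subst σ = C.subst σ

/-- `σ` is a most general unifier of `A` and `C`. -/
def IsMGU (σ : ℕ → Fm) (A C : Fm) : Prop :=
  Unifies σ A C ∧ ∀ τ : ℕ → Fm, Unifies τ A C → ∃ ρ : ℕ → Fm, ∀ k, τ k = (σ k).subst ρ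

/-- Condensed detachment: from the major premiss `maj = i(A,B)` and minor premiss
`minor` (renamed to `C`, sharing no variables with the major premiss), if `σ` is a
most general unifier of `A` and `C`, conclude `Bσ` (up to renaming of variables). -/
def CD (maj minor concl : Fm) : Prop :=
  ∃ (A B C : Fm) (σ : ℕ → Fm),
    maj = Fm.i A B ∧ AlphVar minor C ∧ Disjoint (Fm.i A B).vars C.vars ∧
    IsMGU σ A C ∧ AlphVar (B.subst σ) concl

/-- A formula contains a double negation if it has a subformula of the form `n(n(t))`. -/
def ContainsDN (A : Fm) : Prop := ∃ t : Fm, Fm.Sub (Fm.n (Fm.n t)) A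

/-- Existence of a condensed-detachment proof from axiom set `L` in which every
*deduced* (non-axiom) step satisfies the predicate `allowed`.  A step is an
alphabetic variant of an axiom of `L` or follows from two earlier steps by
condensed detachment. -/
inductive CDProof (L : Set Fm) (allowed : Fm → Prop) : Fm → Prop
  | ax {a b : Fm} : a ∈ L → AlphVar a b → CDProof L allowed b
  | cd {p q c : Fm} : CDProof L allowed p → CDProof L allowed q → CD p q c → allowed c →
      CDProof L allowed c

/-- `B` is provable from `L` by condensed detachment. -/
def CDProvable (L : Set Fm) (B : Fm) : Prop := CDProof L (fun _ => True) B

/-- A formula is double-negation free. -/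
def DNFree (f : Fm) : Prop := ¬ ContainsDN f

/-- `B` has a double-negation-free condensed-detachment proof from `L`
(no deduced step contains a double negation). -/
def DNFreeCDProvable (L : Set Fm) (B : Fm) : Prop := CDProof L DNFree B

/-- Every doubly negated subformula of `f` is (an alphabetic variant of) a doubly
negated subformula of `B`. -/
def DNOk (B : Fm) : Fm → Prop := fun f =>
  ∀ t : Fm, Fm.Sub (Fm.n (Fm.n t)) f → ∃ s : Fm, Fm.Sub (Fm.n (Fm.n s)) B ∧ AlphVar s t

/-- Existence of a proof from axioms `L` and (variable-free) assumptions `Δ` using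
modus ponens and substitution, in which every deduced step satisfies `allowed`. -/
inductive HProof (L Δ : Set Fm) (allowed : Fm → Prop) : Fm → Prop
  | ax {a : Fm} : a ∈ L → HProof L Δ allowed a
  | hyp {a : Fm} : a ∈ Δ → HProof L Δ allowed a
  | mp {a b : Fm} : HProof L Δ allowed (Fm.i a b) → HProof L Δ allowed a → allowed b →
      HProof L Δ allowed b
  | subst {a : Fm} (σ : ℕ → Fm) : HProof L Δ allowed a → allowed (a.subst σ) →
      HProof L Δ allowed (a.subst σ)

/-- Existence of a proof by modus ponens only from the set `S` of premisses, in which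
every deduced step satisfies `allowed`. -/
inductive MPProof (S : Set Fm) (allowed : Fm → Prop) : Fm → Prop
  | prem {a : Fm} : a ∈ S → MPProof S allowed a
  | mp {a b : Fm} : MPProof S allowed (Fm.i a b) → MPProof S allowed a → allowed b →
      MPProof S allowed b

/-- The set of substitution instances of members of `L`. -/
def SubstInstances (L : Set Fm) : Set Fm := {b | ∃ a ∈ L, ∃ σ : ℕ → Fm, b = a.subst σ}

/-- A formula containing no variables. -/
def VarFree (A : Fm) : Prop := A.vars = ∅

/-- Replace all occurrences of the selected doubly negated subformulas `n(n(q))`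
(`q ∈ S`) by `q`. -/
def eraseDN (S : Finset Fm) : Fm → Fm
  | .var k => .var k
  | .i a b => .i (eraseDN S a) (eraseDN S b)
  | .n (.var k) => .n (.var k)
  | .n (.i a b) => .n (.i (eraseDN S a) (eraseDN S b))
  | .n (.n q) => if q ∈ S then eraseDN S q else .n (eraseDN S (.n q))

/-- `L` admits strong double-negation elimination: whenever `B` is provable from `L`
by condensed detachment and `B*` is obtained from `B` by erasing all occurrences of
a chosen set of doubly negated subformulas of `B`, then `B*` has a condensed-detachment
proof from `L` whose deduced steps contain no doubly negated subformulas other than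
(alphabetic variants of) those occurring in `B*`. -/
def StrongDNE (L : Set Fm) : Prop :=
  ∀ (B : Fm) (S : Finset Fm), CDProvable L B → (∀ q ∈ S, Fm.Sub (.n (.n q)) B) →
    CDProof L (DNOk (eraseDN S B)) (eraseDN S B)

/-- Replace every occurrence of the variable `v` by `n(v)` and cancel the resulting
double negations. -/
def flipNeg (v : ℕ) : Fm → Fm
  | .var k => if k = v then .n (.var v) else .var k
  | .i a b => .i (flipNeg v a) (flipNeg v b)
  | .n a => if a = .var v then .var v else .n (flipNeg v a)

/-- Membership in `L*`: the closure of `L` under the operation of replacing a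
negated variable `x` (i.e. one with `n(x)` occurring) everywhere by `n(x)`,
cancelling resulting double negations. -/
inductive StarMem (L : Set Fm) : Fm → Prop
  | base {a : Fm} : a ∈ L → StarMem L a
  | step {a : Fm} {v : ℕ} : StarMem L a → Fm.Sub (.n (.var v)) a → StarMem L (flipNeg v a)

/-- D1 = i(x,x) -/
def D1 : Fm := .i (.var 0) (.var 0)
/-- D2 = i(i(x,x),i(n(x),n(x))) -/
def D2 : Fm := .i (.i (.var 0) (.var 0)) (.i (.n (.var 0)) (.n (.var 0)))
/-- D3 = i(i(x,x),i(i(y,y),i(i(x,y),i(x,y)))) -/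
def D3 : Fm := .i (.i (.var 0) (.var 0))
  (.i (.i (.var 1) (.var 1)) (.i (.i (.var 0) (.var 1)) (.i (.var 0) (.var 1))))

/-- L1 = i(i(x,y),i(i(y,z),i(x,z))) -/
def L1 : Fm := .i (.i (.var 0) (.var 1)) (.i (.i (.var 1) (.var 2)) (.i (.var 0) (.var 2)))
/-- L2 = i(i(n(x),x),x) -/
def L2 : Fm := .i (.i (.n (.var 0)) (.var 0)) (.var 0)
/-- L3 = i(x,i(n(x),y)) -/
def L3 : Fm := .i (.var 0) (.i (.n (.var 0)) (.var 1))
/-- L4 = i(i(x,n(x)),n(x)) -/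
def L4 : Fm := .i (.i (.var 0) (.n (.var 0))) (.n (.var 0))
/-- L5 = i(n(x),i(x,y)) -/
def L5 : Fm := .i (.n (.var 0)) (.i (.var 0) (.var 1))
/-- The Łukasiewicz axiom system for two-valued propositional calculus. -/
def Lax : Set Fm := {L1, L2, L3}

/-- A1 = i(x,i(y,x)) -/
def A1 : Fm := .i (.var 0) (.i (.var 1) (.var 0))
/-- A2 = i(i(x,y),i(i(y,z),i(x,z))) -/
def A2 : Fm := .i (.i (.var 0) (.var 1)) (.i (.i (.var 1) (.var 2)) (.i (.var 0) (.var 2)))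
/-- A3 = i(i(i(x,y),y),i(i(y,x),x)) -/
def A3 : Fm := .i (.i (.i (.var 0) (.var 1)) (.var 1)) (.i (.i (.var 1) (.var 0)) (.var 0))
/-- A4 = i(i(n(x),n(y)),i(y,x)) -/
def A4 : Fm := .i (.i (.n (.var 0)) (.n (.var 1))) (.i (.var 1) (.var 0))
/-- A6 = i(i(x,y),i(n(y),n(x))) -/
def A6 : Fm := .i (.i (.var 0) (.var 1)) (.i (.n (.var 1)) (.n (.var 0)))
/-- A7 = i(i(n(x),y),i(n(y),x)) -/
def A7 : Fm := .i (.i (.n (.var 0)) (.var 1)) (.i (.n (.var 1)) (.var 0))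
/-- A8 = i(i(x,n(y)),i(y,n(x))) -/
def A8 : Fm := .i (.i (.var 0) (.n (.var 1))) (.i (.var 1) (.n (.var 0)))
/-- The axiom system of Łukasiewicz's infinite-valued sentential calculus. -/
def Aax : Set Fm := {A1, A2, A3, A4}

/-- H1 = i(x,i(y,x)) -/
def H1 : Fm := .i (.var 0) (.i (.var 1) (.var 0))
/-- H2 = i(i(x,i(y,z)),i(i(x,y),i(x,z))) -/
def H2 : Fm := .i (.i (.var 0) (.i (.var 1) (.var 2)))
  (.i (.i (.var 0) (.var 1)) (.i (.var 0) (.var 2)))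
/-- H3 = i(i(x,n(x)),n(x)) -/
def H3 : Fm := .i (.i (.var 0) (.n (.var 0))) (.n (.var 0))
/-- H4 = i(x,i(n(x),y)) -/
def H4 : Fm := .i (.var 0) (.i (.n (.var 0)) (.var 1))
/-- The intuitionistic axiom system H. -/
def Hax : Set Fm := {H1, H2, H3, H4}

open Fm Equiv

local infixr:60 "⇒" => Fm.i
local prefix:75 "∼" => Fm.n

/-- The involution of `ℕ` exchanging `k` and `k + 10` for `k < 10`. -/
def shift : Perm ℕ where
  toFun k := if k < 10 then k + 10 else if k < 20 then k - 10 else k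
  invFun k := if k < 10 then k + 10 else if k < 20 then k - 10 else k
  left_inv k := by grind
  right_inv k := by grind

/-- The substitution given by a list of bindings. -/
def bindings : List (ℕ × Fm) → ℕ → Fm
  | [], k => var k
  | (j, t) :: s, k => if k = j then t else bindings s k

theorem bindings_absorbed {τ : ℕ → Fm} {s : List (ℕ × Fm)}
    (h : ∀ b ∈ s, τ b.1 = b.2.subst τ) (k : ℕ) : τ k = (bindings s k).subst τ := by
  induction s with
  | nil => rfl
  | cons b s ih => grind [bindings]

theorem Fm.subst_var (A : Fm) : A.subst var = A := by
  induction A <;> simp_all [subst]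

theorem AlphVar.refl (A : Fm) : AlphVar A A := ⟨1, A.subst_var.symm⟩

@[simp]
theorem dnFree_var (k : ℕ) : DNFree (var k) := by
  rintro ⟨t, h⟩
  cases h

@[simp]
theorem dnFree_i {a b : Fm} : DNFree (a ⇒ b) ↔ DNFree a ∧ DNFree b := by
  refine ⟨fun h => ⟨fun ⟨t, ht⟩ => h ⟨t, .il ht⟩, fun ⟨t, ht⟩ => h ⟨t, .ir ht⟩⟩, ?_⟩
  rintro ⟨ha, hb⟩ ⟨t, h⟩
  cases h with
  | il h => exact ha ⟨t, h⟩
  | ir h => exact hb ⟨t, h⟩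

@[simp]
theorem dnFree_n_var (k : ℕ) : DNFree (∼var k) := by
  rintro ⟨t, h⟩
  cases h with
  | neg h => cases h

@[simp]
theorem dnFree_n_i {a b : Fm} : DNFree (∼(a ⇒ b)) ↔ DNFree (a ⇒ b) := by
  refine ⟨fun h ⟨t, ht⟩ => h ⟨t, .neg ht⟩, ?_⟩
  rintro hab ⟨t, h⟩
  cases h with
  | neg h => exact hab ⟨t, h⟩

/-- Condensed detachment with an explicit idempotent unifier: the variables of the minor premiss
are renamed apart by `shift`, those of the conclusion are normalized by `q`. -/
theorem DNFreeCDProvable.detach {L : Set Fm} {A B M c : Fm}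
    (major : DNFreeCDProvable L (A ⇒ B)) (minor : DNFreeCDProvable L M)
    (q : Perm ℕ) (s : List (ℕ × Fm))
    (apart : Disjoint (A ⇒ B).vars (M.subst (renameSubst shift)).vars := by decide)
    (unifies : Unifies (bindings s) A (M.subst (renameSubst shift)) := by rfl)
    (general : ∀ τ, Unifies τ A (M.subst (renameSubst shift)) → ∀ b ∈ s, τ b.1 = b.2.subst τ := by
      intro τ h
      simp [Unifies, subst, renameSubst, shift] at h ⊢
      grind)
    (concl : c = (B.subst (bindings s)).subst (renameSubst q) := by rfl)
    (free : DNFree c := by simp) :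
    DNFreeCDProvable L c :=
  .cd major minor ⟨A, B, _, bindings s, rfl, ⟨shift, rfl⟩, apart,
    ⟨unifies, fun τ h => ⟨τ, bindings_absorbed (general τ h)⟩⟩, ⟨q, concl⟩⟩ free

theorem provable_L1 :
    DNFreeCDProvable Lax ((var 0 ⇒ var 1) ⇒ (var 1 ⇒ var 2) ⇒ var 0 ⇒ var 2) :=
  .ax (by simp [Lax, L1]) (.refl _)

theorem provable_L2 : DNFreeCDProvable Lax ((∼var 0 ⇒ var 0) ⇒ var 0) :=
  .ax (by simp [Lax, L2]) (.refl _)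

theorem provable_L3 : DNFreeCDProvable Lax (var 0 ⇒ ∼var 0 ⇒ var 1) :=
  .ax (by simp [Lax, L3]) (.refl _)

theorem provable_antecedent_fold :
    DNFreeCDProvable Lax ((((var 0 ⇒ var 1) ⇒ var 2 ⇒ var 1) ⇒ var 3) ⇒ (var 2 ⇒ var 0) ⇒ var 3) :=
  provable_L1.detach provable_L1 (swap 10 3 * swap 10 2 * swap 12 1 * swap 11 0)
    [(0, var 10 ⇒ var 11), (1, (var 11 ⇒ var 12) ⇒ var 10 ⇒ var 12)]

theorem provable_comp_second :
    DNFreeCDProvable Lax ((var 0 ⇒ var 1 ⇒ var 2) ⇒ (var 3 ⇒ var 1) ⇒ var 0 ⇒ var 3 ⇒ var 2) :=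
  provable_antecedent_fold.detach provable_antecedent_fold
    (swap 12 3 * swap 11 2 * swap 10 1 * swap 2 0)
    [(0, var 10 ⇒ var 11), (1, var 12 ⇒ var 11), (3, (var 12 ⇒ var 10) ⇒ var 2 ⇒ var 12 ⇒ var 11),
     (13, var 2 ⇒ var 12 ⇒ var 11)]

theorem provable_comp_antecedent :
    DNFreeCDProvable Lax ((var 0 ⇒ var 1) ⇒ ((var 0 ⇒ var 2) ⇒ var 3) ⇒ (var 1 ⇒ var 2) ⇒ var 3) :=
  provable_antecedent_fold.detach provable_L1 (swap 12 3 * swap 2 1 * swap 2 0)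
    [(3, ((var 2 ⇒ var 1) ⇒ var 12) ⇒ (var 0 ⇒ var 1) ⇒ var 12), (10, var 0 ⇒ var 1),
     (11, var 2 ⇒ var 1)]

theorem provable_comp_nested :
    DNFreeCDProvable Lax
      ((var 0 ⇒ (var 1 ⇒ var 2) ⇒ var 3) ⇒ (var 1 ⇒ var 4) ⇒ var 0 ⇒ (var 4 ⇒ var 2) ⇒ var 3) :=
  provable_comp_second.detach provable_comp_antecedent
    (swap 11 4 * swap 13 3 * swap 12 2 * swap 10 1 * swap 3 0)
    [(0, var 10 ⇒ var 11), (1, (var 10 ⇒ var 12) ⇒ var 13), (2, (var 11 ⇒ var 12) ⇒ var 13)]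

theorem provable_of_neg_imp :
    DNFreeCDProvable Lax (((∼var 0 ⇒ var 1) ⇒ var 2) ⇒ var 0 ⇒ var 2) :=
  provable_L1.detach provable_L3 (swap 11 1 * swap 10 0)
    [(0, var 10), (1, ∼var 10 ⇒ var 11)]

theorem provable_neg_weaken :
    DNFreeCDProvable Lax (var 0 ⇒ ((∼var 0 ⇒ var 1) ⇒ var 2) ⇒ (var 3 ⇒ var 1) ⇒ var 2) :=
  provable_of_neg_imp.detach provable_comp_antecedent (swap 11 3 * swap 13 2 * swap 12 1)
    [(1, var 11), (2, ((∼var 0 ⇒ var 12) ⇒ var 13) ⇒ (var 11 ⇒ var 12) ⇒ var 13), (10, ∼var 0)]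

theorem provable_clavius_weaken :
    DNFreeCDProvable Lax
      (((∼((∼var 0 ⇒ var 0) ⇒ var 0) ⇒ var 1) ⇒ var 2) ⇒ (var 3 ⇒ var 1) ⇒ var 2) :=
  provable_neg_weaken.detach provable_L2 (swap 10 0)
    [(0, (∼var 10 ⇒ var 10) ⇒ var 10)]

theorem provable_clavius_cut :
    DNFreeCDProvable Lax ((var 0 ⇒ (∼var 1 ⇒ var 1) ⇒ var 1) ⇒ (∼var 1 ⇒ var 1) ⇒ var 1) :=
  provable_clavius_weaken.detach provable_L2 (swap 3 1 * swap 3 0)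
    [(1, (∼var 0 ⇒ var 0) ⇒ var 0), (2, (∼var 0 ⇒ var 0) ⇒ var 0), (10, (∼var 0 ⇒ var 0) ⇒ var 0)]

theorem provable_clavius_of :
    DNFreeCDProvable Lax (var 0 ⇒ (∼var 1 ⇒ var 1) ⇒ var 1) :=
  provable_of_neg_imp.detach provable_clavius_cut (swap 11 1)
    [(1, (∼var 11 ⇒ var 11) ⇒ var 11), (2, (∼var 11 ⇒ var 11) ⇒ var 11), (10, ∼var 0)]

theorem provable_dilemma_weak :
    DNFreeCDProvable Lax ((∼var 0 ⇒ var 1) ⇒ var 2 ⇒ (var 1 ⇒ var 0) ⇒ var 0) :=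
  provable_comp_nested.detach provable_clavius_of (swap 10 2 * swap 4 1 * swap 11 0)
    [(0, var 10), (1, ∼var 11), (2, var 11), (3, var 11)]

theorem provable_dilemma_trans :
    DNFreeCDProvable Lax (((var 0 ⇒ (var 1 ⇒ var 2) ⇒ var 2) ⇒ var 3) ⇒ (∼var 2 ⇒ var 1) ⇒ var 3) :=
  provable_L1.detach provable_dilemma_weak (swap 10 3 * swap 10 2 * swap 11 1 * swap 12 0)
    [(0, ∼var 10 ⇒ var 11), (1, var 12 ⇒ (var 11 ⇒ var 10) ⇒ var 10)]

theorem provable_dilemma :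
    DNFreeCDProvable Lax ((∼var 0 ⇒ var 1) ⇒ (var 1 ⇒ var 0) ⇒ var 0) :=
  provable_dilemma_trans.detach provable_L2 (swap 2 0)
    [(0, ∼((var 1 ⇒ var 2) ⇒ var 2)), (3, (var 1 ⇒ var 2) ⇒ var 2), (10, (var 1 ⇒ var 2) ⇒ var 2)]

theorem provable_imp_imp_self :
    DNFreeCDProvable Lax (var 0 ⇒ (var 1 ⇒ var 0) ⇒ var 0) :=
  provable_of_neg_imp.detach provable_dilemma (swap 11 1 * swap 10 0)
    [(0, var 10), (1, var 11), (2, (var 11 ⇒ var 10) ⇒ var 10)]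

theorem provable_imp_imp_chain :
    DNFreeCDProvable Lax ((var 0 ⇒ var 1 ⇒ var 2) ⇒ var 2 ⇒ var 0 ⇒ var 2) :=
  provable_comp_second.detach provable_imp_imp_self (swap 10 2 * swap 11 1 * swap 3 0)
    [(0, var 10), (1, var 11 ⇒ var 10), (2, var 10)]

theorem provable_const_imp :
    DNFreeCDProvable Lax (var 0 ⇒ var 1 ⇒ var 0) :=
  provable_imp_imp_chain.detach provable_L3 (swap 10 1 * swap 11 0)
    [(0, var 10), (1, ∼var 10), (2, var 11)]

theorem provable_drop_antecedent :
    DNFreeCDProvable Lax (((var 0 ⇒ var 1) ⇒ var 2) ⇒ var 1 ⇒ var 2) :=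
  provable_L1.detach provable_const_imp (swap 10 1 * swap 11 0)
    [(0, var 10), (1, var 11 ⇒ var 10)]

theorem provable_apply_imp :
    DNFreeCDProvable Lax (var 0 ⇒ (var 0 ⇒ var 1) ⇒ var 1) :=
  provable_drop_antecedent.detach provable_dilemma (swap 10 1 * swap 11 0)
    [(0, ∼var 10), (1, var 11), (2, (var 11 ⇒ var 10) ⇒ var 10)]

theorem provable_comm :
    DNFreeCDProvable Lax ((var 0 ⇒ var 1 ⇒ var 2) ⇒ var 1 ⇒ var 0 ⇒ var 2) :=
  provable_comp_second.detach provable_apply_imp (swap 11 2 * swap 10 1 * swap 3 0)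
    [(0, var 10), (1, var 10 ⇒ var 11), (2, var 11)]

theorem provable_L5 :
    DNFreeCDProvable Lax (∼var 0 ⇒ var 0 ⇒ var 1) :=
  provable_comm.detach provable_L3 (swap 11 1 * swap 10 0)
    [(0, var 10), (1, ∼var 10), (2, var 11)]

theorem provable_peirce :
    DNFreeCDProvable Lax (((var 0 ⇒ var 1) ⇒ var 0) ⇒ var 0) :=
  provable_dilemma.detach provable_L5 (swap 11 1 * swap 10 0)
    [(0, var 10), (1, var 10 ⇒ var 11)]

theorem provable_clavius_trans :
    DNFreeCDProvable Lax ((var 0 ⇒ var 1) ⇒ (∼var 0 ⇒ var 0) ⇒ var 1) :=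
  provable_L1.detach provable_L2 (swap 2 1 * swap 10 0)
    [(0, ∼var 10 ⇒ var 10), (1, var 10)]

theorem provable_clavius_map :
    DNFreeCDProvable Lax ((((∼var 0 ⇒ var 0) ⇒ var 1) ⇒ var 2) ⇒ (var 0 ⇒ var 1) ⇒ var 2) :=
  provable_L1.detach provable_clavius_trans (swap 11 1 * swap 10 0)
    [(0, var 10 ⇒ var 11), (1, (∼var 10 ⇒ var 10) ⇒ var 11)]

theorem provable_L4 :
    DNFreeCDProvable Lax ((var 0 ⇒ ∼var 0) ⇒ ∼var 0) :=
  provable_clavius_map.detach provable_peirce (swap 11 0)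
    [(0, var 11), (1, ∼var 11), (2, ∼var 11), (10, ∼var 11)]

/-- From the Łukasiewicz axioms L1, L2, L3 there exist double-negation-free
condensed-detachment proofs of L4 = i(i(x,n(x)),n(x)) and L5 = i(n(x),i(x,y)). -/
theorem stmt9 :
    DNFreeCDProvable Lax L4 ∧ DNFreeCDProvable Lax L5 := by
  exact ⟨provable_L4, provable_L5⟩
end

section
/- From the axioms A1, A2, A3, A4 of Łukasiewicz's infinite-valued sentential calculus, there exist double-negation-free condensed-detachment proofs of each of the formulas D1, D2, and D3. -/
namespace Fm

/-- Boolean test for the absence of double negations. -/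
def dnFree : Fm → Bool
  | var _ => true
  | i a b => dnFree a && dnFree b
  | n (n _) => false
  | n (var _) => true
  | n (i a b) => dnFree a && dnFree b

theorem dnFree_of_sub {s t : Fm} (h : Sub s t) (ht : t.dnFree = true) : s.dnFree = true := by
  induction h with
  | refl => exact ht
  | il _ ih => exact ih (by simp_all [dnFree])
  | ir _ ih => exact ih (by simp_all [dnFree])
  | @neg a _ ih => exact ih (by cases a <;> simp_all [dnFree])

theorem DNFree_of_dnFree {f : Fm} (h : f.dnFree = true) : DNFree f := by
  rintro ⟨t, ht⟩
  simpa [dnFree] using dnFree_of_sub ht h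

theorem subst_var_s12 (t : Fm) : t.subst var = t := by
  induction t <;> simp_all [subst]

/-- The substitution given by a finite list of bindings, the identity elsewhere. -/
def bindings : List (ℕ × Fm) → ℕ → Fm
  | [], k => var k
  | (v, t) :: l, k => if k = v then t else bindings l k

theorem subst_bindings_of_forall {l : List (ℕ × Fm)} {τ : ℕ → Fm}
    (h : ∀ b ∈ l, τ b.1 = b.2.subst τ) (k : ℕ) : τ k = (bindings l k).subst τ := by
  induction l with
  | nil => rfl
  | cons b l ih =>
    rw [List.forall_mem_cons] at h
    simp only [bindings]
    split_ifs with hk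
    · exact hk ▸ h.1
    · exact ih h.2

/-- A renaming that separates any two formulas whose variables all lie below `8`. -/
def offset : Equiv.Perm ℕ :=
  Function.Involutive.toPerm (· ^^^ 8) fun k => Nat.xor_xor_cancel_right k 8

theorem alphVar_refl (a : Fm) : AlphVar a a := ⟨1, (subst_var_s12 a).symm⟩

theorem offset_apply (k : ℕ) : offset k = k ^^^ 8 := rfl

/-- Condensed detachment with the most general unifier given in solved form. -/
theorem detach {L : Set Fm} {A B M c : Fm} (l : List (ℕ × Fm)) (p : Equiv.Perm ℕ)
    (hmaj : DNFreeCDProvable L (i A B)) (hmin : DNFreeCDProvable L M)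
    (hdisj : Disjoint (i A B).vars (M.subst (renameSubst offset)).vars)
    (hunif : Unifies (bindings l) A (M.subst (renameSubst offset)))
    (hmgu : ∀ τ, Unifies τ A (M.subst (renameSubst offset)) → ∀ b ∈ l, τ b.1 = b.2.subst τ)
    (hc : c = (B.subst (bindings l)).subst (renameSubst p)) (hfree : c.dnFree = true) :
    DNFreeCDProvable L c :=
  .cd hmaj hmin ⟨A, B, _, bindings l, rfl, ⟨offset, rfl⟩, hdisj,
    ⟨hunif, fun τ h => ⟨τ, subst_bindings_of_forall (hmgu τ h)⟩⟩, p, hc⟩ (DNFree_of_dnFree hfree)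

namespace Lukasiewicz

theorem ax1 :
    DNFreeCDProvable Aax (i (var 0) (i (var 1) (var 0))) :=
  .ax (a := A1) (by simp [Aax]) (alphVar_refl _)

theorem ax2 :
    DNFreeCDProvable Aax (i (i (var 0) (var 1)) (i (i (var 1) (var 2)) (i (var 0) (var 2)))) :=
  .ax (a := A2) (by simp [Aax]) (alphVar_refl _)

theorem ax3 :
    DNFreeCDProvable Aax (i (i (i (var 0) (var 1)) (var 1)) (i (i (var 1) (var 0)) (var 0))) :=
  .ax (a := A3) (by simp [Aax]) (alphVar_refl _)

theorem ax4 :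
    DNFreeCDProvable Aax (i (i (n (var 0)) (n (var 1))) (i (var 1) (var 0))) :=
  .ax (a := A4) (by simp [Aax]) (alphVar_refl _)

theorem weaken_antecedent :
    DNFreeCDProvable Aax (i (i (i (var 0) (var 1)) (var 2)) (i (var 1) (var 2))) :=
  detach [(1, i (var 9) (var 0)), (8, var 0)]
    (Equiv.swap 1 9 * Equiv.swap 0 9) ax2 ax1
    (by decide) rfl (fun τ h => by
      simp only [Unifies, subst, renameSubst, offset_apply] at h
      simp only [List.forall_mem_cons, subst]
      grind) rfl rfl

theorem assertion :
    DNFreeCDProvable Aax (i (var 0) (i (i (var 0) (var 1)) (var 1))) :=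
  detach [(0, i (var 8) (var 1)), (2, i (i (var 1) (var 8)) (var 8)), (9, var 1)]
    (Equiv.swap 1 8 * Equiv.swap 0 1) weaken_antecedent ax3
    (by decide) rfl (fun τ h => by
      simp only [Unifies, subst, renameSubst, offset_apply] at h
      simp only [List.forall_mem_cons, subst]
      grind) rfl rfl

theorem lift_suffixing :
    DNFreeCDProvable Aax
      (i (i (i (i (var 0) (var 1)) (i (var 2) (var 1))) (var 3)) (i (i (var 2) (var 0)) (var 3))) :=
  detach [(0, i (var 8) (var 9)), (1, i (i (var 9) (var 10)) (i (var 8) (var 10)))]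
    (Equiv.swap 3 8 * Equiv.swap 2 8 * Equiv.swap 1 10 * Equiv.swap 0 9) ax2 ax2
    (by decide) rfl (fun τ h => by
      simp only [Unifies, subst, renameSubst, offset_apply] at h
      simp only [List.forall_mem_cons, subst]
      grind) rfl rfl

theorem nested_suffixing :
    DNFreeCDProvable Aax
      (i (i (var 0) (i (var 1) (var 2))) (i (i (var 3) (var 1)) (i (var 0) (i (var 3) (var 2))))) :=
  detach [(0, i (var 8) (var 9)),
      (1, i (var 10) (var 9)),
      (3, i (i (var 10) (var 8)) (i (var 2) (i (var 10) (var 9)))),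
      (11, i (var 2) (i (var 10) (var 9)))]
    (Equiv.swap 3 10 * Equiv.swap 2 9 * Equiv.swap 1 8 * Equiv.swap 0 2) lift_suffixing lift_suffixing
    (by decide) rfl (fun τ h => by
      simp only [Unifies, subst, renameSubst, offset_apply] at h
      simp only [List.forall_mem_cons, subst]
      grind) rfl rfl

theorem commutation :
    DNFreeCDProvable Aax (i (i (var 0) (i (var 1) (var 2))) (i (var 1) (i (var 0) (var 2)))) :=
  detach [(1, i (var 0) (var 2)), (8, var 0), (9, var 2)]
    (Equiv.swap 1 3 * Equiv.swap 0 3) nested_suffixing assertion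
    (by decide) rfl (fun τ h => by
      simp only [Unifies, subst, renameSubst, offset_apply] at h
      simp only [List.forall_mem_cons, subst]
      grind) rfl rfl

theorem const_identity :
    DNFreeCDProvable Aax (i (var 0) (i (var 1) (var 1))) :=
  detach [(2, var 0), (8, var 0), (9, var 1)]
    (Equiv.swap 0 1) commutation ax1
    (by decide) rfl (fun τ h => by
      simp only [Unifies, subst, renameSubst, offset_apply] at h
      simp only [List.forall_mem_cons, subst]
      grind) rfl rfl

theorem identity :
    DNFreeCDProvable Aax (i (var 0) (var 0)) :=
  detach [(0, i (var 8) (i (var 9) (var 8)))]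
    (Equiv.swap 0 1) const_identity ax1
    (by decide) rfl (fun τ h => by
      simp only [Unifies, subst, renameSubst, offset_apply] at h
      simp only [List.forall_mem_cons, subst]
      grind) rfl rfl

theorem prefixing :
    DNFreeCDProvable Aax (i (i (var 0) (var 1)) (i (i (var 2) (var 0)) (i (var 2) (var 1)))) :=
  detach [(0, i (var 8) (var 9)), (1, i (var 9) (var 10)), (2, i (var 8) (var 10))]
    (Equiv.swap 2 8 * Equiv.swap 1 10 * Equiv.swap 0 9) commutation ax2
    (by decide) rfl (fun τ h => by
      simp only [Unifies, subst, renameSubst, offset_apply] at h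
      simp only [List.forall_mem_cons, subst]
      grind) rfl rfl

theorem elim_identity :
    DNFreeCDProvable Aax (i (i (i (var 0) (var 0)) (var 1)) (var 1)) :=
  detach [(0, i (var 8) (var 8))]
    (Equiv.swap 0 8) assertion identity
    (by decide) rfl (fun τ h => by
      simp only [Unifies, subst, renameSubst, offset_apply] at h
      simp only [List.forall_mem_cons, subst]
      grind) rfl rfl

theorem absorb_identity :
    DNFreeCDProvable Aax (i (i (var 0) (i (var 1) (var 1))) (i (var 1) (var 1))) :=
  detach [(0, i (var 8) (var 8)), (9, var 1)]
    (Equiv.swap 1 8 * Equiv.swap 0 1) ax3 elim_identity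
    (by decide) rfl (fun τ h => by
      simp only [Unifies, subst, renameSubst, offset_apply] at h
      simp only [List.forall_mem_cons, subst]
      grind) rfl rfl

theorem identity_of_identity :
    DNFreeCDProvable Aax (i (i (var 0) (var 0)) (i (var 0) (var 0))) :=
  detach [(1, i (var 9) (var 9)), (2, i (var 9) (var 9)), (8, var 0)]
    (Equiv.swap 0 9) weaken_antecedent absorb_identity
    (by decide) rfl (fun τ h => by
      simp only [Unifies, subst, renameSubst, offset_apply] at h
      simp only [List.forall_mem_cons, subst]
      grind) rfl rfl

theorem unify_antecedent :
    DNFreeCDProvable Aax (i (i (i (var 0) (var 0)) (var 1)) (i (i (var 0) (var 0)) (var 1))) :=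
  detach [(0, i (var 8) (var 8)), (1, i (var 8) (var 8))]
    (Equiv.swap 1 2 * Equiv.swap 0 8) ax2 identity_of_identity
    (by decide) rfl (fun τ h => by
      simp only [Unifies, subst, renameSubst, offset_apply] at h
      simp only [List.forall_mem_cons, subst]
      grind) rfl rfl

theorem identity_of_antecedent :
    DNFreeCDProvable Aax (i (i (var 0) (var 1)) (i (var 0) (var 0))) :=
  detach [(2, var 1), (3, i (var 1) (var 1)), (8, i (var 0) (var 1)), (9, var 1)]
    (Equiv.swap 0 1) lift_suffixing absorb_identity
    (by decide) rfl (fun τ h => by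
      simp only [Unifies, subst, renameSubst, offset_apply] at h
      simp only [List.forall_mem_cons, subst]
      grind) rfl rfl

theorem ex_falso :
    DNFreeCDProvable Aax (i (n (var 0)) (i (var 0) (var 1))) :=
  detach [(0, n (var 8)), (1, n (var 9)), (2, i (var 9) (var 8))]
    (Equiv.swap 1 8 * Equiv.swap 0 9) weaken_antecedent ax4
    (by decide) rfl (fun τ h => by
      simp only [Unifies, subst, renameSubst, offset_apply] at h
      simp only [List.forall_mem_cons, subst]
      grind) rfl rfl

theorem ex_falso_suffixing :
    DNFreeCDProvable Aax (i (i (i (var 0) (var 1)) (var 2)) (i (n (var 0)) (var 2))) :=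
  detach [(0, n (var 8)), (1, i (var 8) (var 9))]
    (Equiv.swap 1 9 * Equiv.swap 0 8) ax2 ex_falso
    (by decide) rfl (fun τ h => by
      simp only [Unifies, subst, renameSubst, offset_apply] at h
      simp only [List.forall_mem_cons, subst]
      grind) rfl rfl

theorem neg_of_imp :
    DNFreeCDProvable Aax (i (i (var 0) (var 1)) (i (n (var 1)) (i (var 0) (var 2)))) :=
  detach [(3, i (n (var 0)) (i (var 2) (var 1))),
      (8, var 0),
      (9, var 1),
      (10, i (var 2) (var 1))]
    (Equiv.swap 1 2 * Equiv.swap 0 2) lift_suffixing ex_falso_suffixing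
    (by decide) rfl (fun τ h => by
      simp only [Unifies, subst, renameSubst, offset_apply] at h
      simp only [List.forall_mem_cons, subst]
      grind) rfl rfl

theorem neg_of_imp_suffixing :
    DNFreeCDProvable Aax
      (i (i (i (n (var 0)) (i (var 1) (var 2))) (var 3)) (i (i (var 1) (var 0)) (var 3))) :=
  detach [(0, i (var 8) (var 9)), (1, i (n (var 9)) (i (var 8) (var 10)))]
    (Equiv.swap 3 10 * Equiv.swap 2 10 * Equiv.swap 1 8 * Equiv.swap 0 9) ax2 neg_of_imp
    (by decide) rfl (fun τ h => by
      simp only [Unifies, subst, renameSubst, offset_apply] at h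
      simp only [List.forall_mem_cons, subst]
      grind) rfl rfl

theorem neg_identity_of_imp :
    DNFreeCDProvable Aax (i (i (var 0) (var 1)) (i (n (var 1)) (n (var 1)))) :=
  detach [(3, i (n (var 0)) (n (var 0))), (8, n (var 0)), (9, i (var 1) (var 2))]
    (Equiv.swap 0 1) neg_of_imp_suffixing identity_of_antecedent
    (by decide) rfl (fun τ h => by
      simp only [Unifies, subst, renameSubst, offset_apply] at h
      simp only [List.forall_mem_cons, subst]
      grind) rfl rfl

theorem neg_identity :
    DNFreeCDProvable Aax (i (i (var 0) (var 0)) (i (n (var 0)) (n (var 0)))) :=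
  detach [(1, i (n (var 0)) (n (var 0))), (8, var 0), (9, var 0)]
    (1) unify_antecedent neg_identity_of_imp
    (by decide) rfl (fun τ h => by
      simp only [Unifies, subst, renameSubst, offset_apply] at h
      simp only [List.forall_mem_cons, subst]
      grind) rfl rfl

theorem prefixing_suffixing :
    DNFreeCDProvable Aax
      (i (i (i (i (var 0) (var 1)) (i (var 0) (var 2))) (var 3)) (i (i (var 1) (var 2)) (var 3))) :=
  detach [(0, i (var 8) (var 9)), (1, i (i (var 10) (var 8)) (i (var 10) (var 9)))]
    (Equiv.swap 3 9 * Equiv.swap 2 9 * Equiv.swap 1 8 * Equiv.swap 0 10) ax2 prefixing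
    (by decide) rfl (fun τ h => by
      simp only [Unifies, subst, renameSubst, offset_apply] at h
      simp only [List.forall_mem_cons, subst]
      grind) rfl rfl

theorem imp_congr :
    DNFreeCDProvable Aax
      (i (i (var 0) (var 1)) (i (i (var 2) (var 3)) (i (i (var 3) (var 0)) (i (var 2) (var 1))))) :=
  detach [(3, i (i (var 11) (var 0)) (i (i (var 0) (var 1)) (i (var 11) (var 2)))),
      (8, i (var 0) (var 1)),
      (9, var 0),
      (10, var 2)]
    (Equiv.swap 3 11 * Equiv.swap 2 11 * Equiv.swap 1 2 * Equiv.swap 0 1) prefixing_suffixing nested_suffixing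
    (by decide) rfl (fun τ h => by
      simp only [Unifies, subst, renameSubst, offset_apply] at h
      simp only [List.forall_mem_cons, subst]
      grind) rfl rfl

theorem imp_congr_right :
    DNFreeCDProvable Aax
      (i (i (var 0) (var 0)) (i (i (var 1) (var 2)) (i (i (var 2) (var 0)) (i (var 1) (var 0))))) :=
  detach [(1, i (i (var 10) (var 11)) (i (i (var 11) (var 0)) (i (var 10) (var 0)))),
      (8, var 0),
      (9, var 0)]
    (Equiv.swap 2 11 * Equiv.swap 1 10) unify_antecedent imp_congr
    (by decide) rfl (fun τ h => by
      simp only [Unifies, subst, renameSubst, offset_apply] at h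
      simp only [List.forall_mem_cons, subst]
      grind) rfl rfl

theorem imp_congr_right_comm :
    DNFreeCDProvable Aax
      (i (i (var 0) (var 1)) (i (i (var 2) (var 2)) (i (i (var 1) (var 2)) (i (var 0) (var 2))))) :=
  detach [(0, i (var 8) (var 8)),
      (1, i (var 9) (var 10)),
      (2, i (i (var 10) (var 8)) (i (var 9) (var 8)))]
    (Equiv.swap 2 8 * Equiv.swap 1 10 * Equiv.swap 0 9) commutation imp_congr_right
    (by decide) rfl (fun τ h => by
      simp only [Unifies, subst, renameSubst, offset_apply] at h
      simp only [List.forall_mem_cons, subst]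
      grind) rfl rfl

theorem imp_identity :
    DNFreeCDProvable Aax
      (i (i (var 0) (var 0)) (i (i (var 1) (var 1)) (i (i (var 0) (var 1)) (i (var 0) (var 1))))) :=
  detach [(1, i (i (var 10) (var 10)) (i (i (var 0) (var 10)) (i (var 0) (var 10)))),
      (8, var 0),
      (9, var 0)]
    (Equiv.swap 1 10) unify_antecedent imp_congr_right_comm
    (by decide) rfl (fun τ h => by
      simp only [Unifies, subst, renameSubst, offset_apply] at h
      simp only [List.forall_mem_cons, subst]
      grind) rfl rfl

end Lukasiewicz

end Fm

/-- From the axioms A1-A4 of Łukasiewicz's infinite-valued sentential calculus there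
exist double-negation-free condensed-detachment proofs of D1, D2, and D3. -/
theorem stmt12 :
    DNFreeCDProvable Aax D1 ∧ DNFreeCDProvable Aax D2 ∧ DNFreeCDProvable Aax D3 :=
  ⟨Fm.Lukasiewicz.identity, Fm.Lukasiewicz.neg_identity, Fm.Lukasiewicz.imp_identity⟩
end
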